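/- Fix integers w ≥ 2 and m ≥ 2, and consider the query Q_w = (⋈_{1 ≤ i < j ≤ w+1} R_{i,j}(v_i, v_j)) ⋈ U(v_1, …, v_{w+1}) with GAO v_1, …, v_{w+1}, on the instance U = [m]^{w+1}; R_{i,j} = [m] × [m] for all 1 ≤ i < j ≤ w; R_{i,w+1} = [m] × {1} for every i ∈ [w−1]; and R_{w,w+1} = [m] × {2}. Then the output of Q_w on this instance is empty, and the instance admits a certificate of emptiness of size at most c · w · m for an absolute constant c. -/

import Mathlib

/-! Core model of indexed natural-join queries, arguments and certificates. -/

/-- `x` is a valid index tuple for a search tree with fanout function `f` and depth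
(arity) `ar`: it is nonempty, of length at most `ar`, and every coordinate is `1`-based
and within the fanout of the corresponding prefix. -/
def ValidIdx (f : List ℕ → ℕ) (ar : ℕ) (x : List ℕ) : Prop :=
  x ≠ [] ∧ x.length ≤ ar ∧
    ∀ j : Fin x.length, 1 ≤ x.get j ∧ x.get j ≤ f (x.take j.val)

/-- `v` is a valid valuation (a "database instance") for the search-tree shape `(f, ar)`:
the values assigned to the children of a common prefix strictly increase. -/
def IsInstVal (f : List ℕ → ℕ) (ar : ℕ) (v : List ℕ → ℕ) : Prop :=
  ∀ (x : List ℕ) (i : ℕ), ValidIdx f ar (x ++ [i]) → ValidIdx f ar (x ++ [i + 1]) →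
    v (x ++ [i]) < v (x ++ [i + 1])

/-- A symbolic comparison `R[x] θ S[y]` between two variables, `θ ∈ {<, =, >}`. -/
structure Comp (ι : Type) where
  R : ι
  x : List ℕ
  S : ι
  y : List ℕ
  o : Ordering
deriving DecidableEq

variable {n : ℕ} {ι : Type}

/-- The list of attributes of relation `R`, in the order of the GAO `ρ`. -/
def attrList (attrs : ι → Finset (Fin n)) (ρ : List (Fin n)) (R : ι) : List (Fin n) :=
  ρ.filter (fun a => decide (a ∈ attrs R))

/-- The arity of relation `R`. -/
def arity (attrs : ι → Finset (Fin n)) (ρ : List (Fin n)) (R : ι) : ℕ :=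
  (attrList attrs ρ R).length

/-- Well-formedness of a comparison: both index tuples are valid, and the two variables
are on the same attribute. -/
def CompWF (attrs : ι → Finset (Fin n)) (ρ : List (Fin n)) (f : ι → List ℕ → ℕ)
    (c : Comp ι) : Prop :=
  ValidIdx (f c.R) (arity attrs ρ c.R) c.x ∧
  ValidIdx (f c.S) (arity attrs ρ c.S) c.y ∧
  (attrList attrs ρ c.R)[c.x.length - 1]? = (attrList attrs ρ c.S)[c.y.length - 1]?

/-- The valuation `v` satisfies the comparison `c`. -/
def SatComp (v : ι → List ℕ → ℕ) (c : Comp ι) : Prop :=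
  compare (v c.R c.x) (v c.S c.y) = c.o

/-- `W` is a witness: one full valid index tuple per relation, all contributing to a common
output tuple `t`. -/
def IsWitness (attrs : ι → Finset (Fin n)) (ρ : List (Fin n)) (f : ι → List ℕ → ℕ)
    (v : ι → List ℕ → ℕ) (W : ι → List ℕ) : Prop :=
  (∀ R, ValidIdx (f R) (arity attrs ρ R) (W R) ∧ (W R).length = arity attrs ρ R) ∧
  ∃ t : Fin n → ℕ, ∀ (R : ι) (j : ℕ) (a : Fin n),
    (attrList attrs ρ R)[j]? = some a → v R ((W R).take (j + 1)) = t a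

/-- `A` is a certificate for the shape `f`: all its comparisons are well-formed, and any two
valuations (database instances with this index structure) satisfying all comparisons of `A`
have exactly the same witnesses. -/
def IsCert (attrs : ι → Finset (Fin n)) (ρ : List (Fin n)) (f : ι → List ℕ → ℕ)
    (A : Finset (Comp ι)) : Prop :=
  (∀ c ∈ A, CompWF attrs ρ f c) ∧
  ∀ v v' : ι → List ℕ → ℕ,
    (∀ R, IsInstVal (f R) (arity attrs ρ R) (v R)) →
    (∀ R, IsInstVal (f R) (arity attrs ρ R) (v' R)) →
    (∀ c ∈ A, SatComp v c) → (∀ c ∈ A, SatComp v' c) →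
    ∀ W, IsWitness attrs ρ f v W ↔ IsWitness attrs ρ f v' W

/-! The search tree (trie) derived from raw relational data. -/

/-- The `k`-th smallest element of a finite set of naturals (`1`-based). -/
def nthVal (s : Finset ℕ) (k : ℕ) : ℕ := (s.sort (· ≤ ·)).getD (k - 1) 0

/-- The list of values along the path of index tuple `x` in the search tree of the data
`D` with attribute list `L`. -/
def dbValList : List ℕ → Finset (Fin n → ℕ) → List (Fin n) → List ℕ
  | [], _, _ => []
  | _ :: _, _, [] => []
  | i :: xs, D, a :: L' =>
    let w := nthVal (D.image (fun t => t a)) i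
    w :: dbValList xs (D.filter (fun t => t a = w)) L'

/-- The fanout below index tuple `x` in the search tree of the data `D` with attribute
list `L`. -/
def dbFanout : List ℕ → Finset (Fin n → ℕ) → List (Fin n) → ℕ
  | _, _, [] => 0
  | [], D, a :: _ => (D.image (fun t => t a)).card
  | i :: xs, D, a :: L' =>
    let w := nthVal (D.image (fun t => t a)) i
    dbFanout xs (D.filter (fun t => t a = w)) L'

/-- The index structure (shape) of the database `DB`, indexed consistently with the GAO
`ρ`. -/
def dbShape (attrs : ι → Finset (Fin n)) (ρ : List (Fin n))
    (DB : ι → Finset (Fin n → ℕ)) : ι → List ℕ → ℕ :=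
  fun R x => dbFanout x (DB R) (attrList attrs ρ R)

/-- The value of the variable `R[x]` in the search trees of the database `DB`, indexed
consistently with the GAO `ρ`. -/
def dbValue (attrs : ι → Finset (Fin n)) (ρ : List (Fin n))
    (DB : ι → Finset (Fin n → ℕ)) : ι → List ℕ → ℕ :=
  fun R x => (dbValList x (DB R) (attrList attrs ρ R)).getD (x.length - 1) 0

/-- Relation indices for the query `Q_w`: one binary relation `R_{i,j}` for every pair
`i < j` of the `w + 1` attributes, plus the full relation `U(v_1, …, v_{w+1})`. -/
abbrev TWIdx (w : ℕ) : Type := {p : Fin (w + 1) × Fin (w + 1) // p.1 < p.2} ⊕ Unit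

/-- Attribute sets of `Q_w`: `R_{i,j}` has attributes `{v_i, v_j}` and `U` has all of them. -/
def twAttrs (w : ℕ) : TWIdx w → Finset (Fin (w + 1))
  | Sum.inl p => {p.val.1, p.val.2}
  | Sum.inr _ => Finset.univ

/-- The pairs of the relation `R_{i,j}` (with `i < j`, `0`-based): `[m] × [m]` when
`j ≤ w` (`1`-based), `[m] × {1}` when `j = w + 1` and `i ∈ [w-1]`, and `[m] × {2}` when
`(i,j) = (w, w+1)`. -/
def twPairs (w m : ℕ) (p : Fin (w + 1) × Fin (w + 1)) : Finset (ℕ × ℕ) :=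
  if (p.2 : ℕ) = w then
    (if (p.1 : ℕ) = w - 1 then Finset.Icc 1 m ×ˢ {2} else Finset.Icc 1 m ×ˢ {1})
  else Finset.Icc 1 m ×ˢ Finset.Icc 1 m

/-- The data of the instance: the binary relations are given by `twPairs`, and
`U = [m]^{w+1}`. -/
def twDB (w m : ℕ) : TWIdx w → Finset (Fin (w + 1) → ℕ)
  | Sum.inl p =>
      (twPairs w m p.val).image
        (fun q => fun a => if a = p.val.1 then q.1 else if a = p.val.2 then q.2 else 0)
  | Sum.inr _ => Fintype.piFinset (fun _ : Fin (w + 1) => Finset.Icc 1 m)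

lemma attrList_twAttrs_inl (w : ℕ) (p : {p : Fin (w + 1) × Fin (w + 1) // p.1 < p.2}) :
    attrList (twAttrs w) (List.finRange (w + 1)) (Sum.inl p) = [p.val.1, p.val.2] := by
  have hsorted : (attrList (twAttrs w) (List.finRange (w + 1)) (Sum.inl p)).Pairwise (· < ·) :=
    (List.pairwise_lt_finRange (w + 1)).filter _
  have hpair : [p.val.1, p.val.2].Pairwise (· < ·) := by simpa using p.property
  have hperm : (attrList (twAttrs w) (List.finRange (w + 1)) (Sum.inl p)).Perm
      [p.val.1, p.val.2] := by
    rw [List.perm_ext_iff_of_nodup (hsorted.imp ne_of_lt) (hpair.imp ne_of_lt)]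
    intro a
    simp [attrList, twAttrs]
  exact hperm.eq_of_pairwise (fun a b _ _ h₁ h₂ => absurd h₁ h₂.asymm) hsorted hpair

lemma arity_twAttrs_inl (w : ℕ) (p : {p : Fin (w + 1) × Fin (w + 1) // p.1 < p.2}) :
    arity (twAttrs w) (List.finRange (w + 1)) (Sum.inl p) = 2 := by
  simp [arity, attrList_twAttrs_inl]

lemma nthVal_mem {s : Finset ℕ} {k : ℕ} (h₁ : 1 ≤ k) (h₂ : k ≤ s.card) : nthVal s k ∈ s := by
  have hlt : k - 1 < (s.sort (· ≤ ·)).length := by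
    rw [Finset.length_sort]
    omega
  rw [nthVal, List.getD_eq_getElem _ _ hlt]
  exact (Finset.mem_sort _).1 (List.getElem_mem hlt)

lemma nthVal_singleton_one (c : ℕ) : nthVal {c} 1 = c := by
  simpa using nthVal_mem (s := {c}) le_rfl (by simp)

/-- The first column of `R_{i,j}` is `[m]`, and every value in it is paired with just `c`. -/
structure IsConstRel (w m : ℕ) (p : {p : Fin (w + 1) × Fin (w + 1) // p.1 < p.2})
    (c : ℕ) : Prop where
  pairs_eq : twPairs w m p.val = Finset.Icc 1 m ×ˢ {c}

namespace IsConstRel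

variable {w m c : ℕ} {p : {p : Fin (w + 1) × Fin (w + 1) // p.1 < p.2}}

lemma mem_twDB (h : IsConstRel w m p c) {u : Fin (w + 1) → ℕ} (hu : u ∈ twDB w m (Sum.inl p)) :
    u p.val.2 = c := by
  simp only [twDB, h.pairs_eq, Finset.mem_image, Finset.mem_product, Finset.mem_singleton] at hu
  obtain ⟨q, hq, rfl⟩ := hu
  simp [p.property.ne', hq.2]

lemma image_fst (h : IsConstRel w m p c) :
    (twDB w m (Sum.inl p)).image (fun t => t p.val.1) = Finset.Icc 1 m := by
  ext x
  simp [twDB, h.pairs_eq]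

lemma image_snd (h : IsConstRel w m p c) {x : ℕ} (hx : x ∈ Finset.Icc 1 m) :
    ((twDB w m (Sum.inl p)).filter (fun t => t p.val.1 = x)).image (fun t => t p.val.2) = {c} := by
  apply Finset.eq_singleton_iff_unique_mem.2
  constructor
  · obtain ⟨u, hu, hux⟩ := Finset.mem_image.1 (h.image_fst ▸ hx)
    exact Finset.mem_image.2 ⟨u, Finset.mem_filter.2 ⟨hu, hux⟩, h.mem_twDB hu⟩
  · intro y hy
    obtain ⟨u, hu, rfl⟩ := Finset.mem_image.1 hy
    exact h.mem_twDB (Finset.mem_filter.1 hu).1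

lemma nthVal_fst_mem (h : IsConstRel w m p c) {x : ℕ} (hx : x ∈ Finset.Icc 1 m) :
    nthVal ((twDB w m (Sum.inl p)).image (fun t => t p.val.1)) x ∈ Finset.Icc 1 m := by
  rw [h.image_fst]
  rw [Finset.mem_Icc] at hx
  exact nthVal_mem hx.1 (by simpa using hx.2)

lemma dbShape_nil (h : IsConstRel w m p c) :
    dbShape (twAttrs w) (List.finRange (w + 1)) (twDB w m) (Sum.inl p) [] = m := by
  simp [dbShape, attrList_twAttrs_inl, dbFanout, h.image_fst]

lemma dbShape_singleton (h : IsConstRel w m p c) {x : ℕ} (hx : x ∈ Finset.Icc 1 m) :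
    dbShape (twAttrs w) (List.finRange (w + 1)) (twDB w m) (Sum.inl p) [x] = 1 := by
  simp only [dbShape, attrList_twAttrs_inl, dbFanout]
  rw [h.image_snd (h.nthVal_fst_mem hx), Finset.card_singleton]

lemma dbValue_pair (h : IsConstRel w m p c) {x : ℕ} (hx : x ∈ Finset.Icc 1 m) :
    dbValue (twAttrs w) (List.finRange (w + 1)) (twDB w m) (Sum.inl p) [x, 1] = c := by
  simp only [dbValue, attrList_twAttrs_inl, dbValList]
  rw [h.image_snd (h.nthVal_fst_mem hx), nthVal_singleton_one]
  simp

lemma validIdx_pair (h : IsConstRel w m p c) {x : ℕ} (hx : x ∈ Finset.Icc 1 m) :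
    ValidIdx (dbShape (twAttrs w) (List.finRange (w + 1)) (twDB w m) (Sum.inl p))
      (arity (twAttrs w) (List.finRange (w + 1)) (Sum.inl p)) [x, 1] := by
  refine ⟨by simp, by simp [arity_twAttrs_inl], fun j => ?_⟩
  match j with
  | ⟨0, _⟩ => simpa [h.dbShape_nil] using hx
  | ⟨1, _⟩ => simp [h.dbShape_singleton hx]

lemma eq_pair_of_validIdx (h : IsConstRel w m p c) {x : List ℕ}
    (hx : ValidIdx (dbShape (twAttrs w) (List.finRange (w + 1)) (twDB w m) (Sum.inl p))
      (arity (twAttrs w) (List.finRange (w + 1)) (Sum.inl p)) x)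
    (hlen : x.length = arity (twAttrs w) (List.finRange (w + 1)) (Sum.inl p)) :
    ∃ i ∈ Finset.Icc 1 m, x = [i, 1] := by
  rw [arity_twAttrs_inl] at hlen
  obtain ⟨i, k, rfl⟩ := List.length_eq_two.1 hlen
  have hi : i ∈ Finset.Icc 1 m := by simpa [h.dbShape_nil] using hx.2.2 ⟨0, by simp⟩
  have hk : 1 ≤ k ∧ k ≤ 1 := by simpa [h.dbShape_singleton hi] using hx.2.2 ⟨1, by simp⟩
  exact ⟨i, hi, by rw [le_antisymm hk.2 hk.1]⟩

lemma exists_value_eq_of_isWitness (h : IsConstRel w m p c) {v : TWIdx w → List ℕ → ℕ}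
    {W : TWIdx w → List ℕ} {t : Fin (w + 1) → ℕ}
    (hW : ValidIdx (dbShape (twAttrs w) (List.finRange (w + 1)) (twDB w m) (Sum.inl p))
      (arity (twAttrs w) (List.finRange (w + 1)) (Sum.inl p)) (W (Sum.inl p)) ∧
      (W (Sum.inl p)).length = arity (twAttrs w) (List.finRange (w + 1)) (Sum.inl p))
    (ht : ∀ (R : TWIdx w) (j : ℕ) (a : Fin (w + 1)),
      (attrList (twAttrs w) (List.finRange (w + 1)) R)[j]? = some a →
        v R ((W R).take (j + 1)) = t a) :
    ∃ i ∈ Finset.Icc 1 m, v (Sum.inl p) [i, 1] = t p.val.2 := by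
  obtain ⟨i, hi, hWi⟩ := h.eq_pair_of_validIdx hW.1 hW.2
  refine ⟨i, hi, ?_⟩
  simpa [hWi] using ht (Sum.inl p) 1 p.val.2 (by simp [attrList_twAttrs_inl])

end IsConstRel

/-- The comparisons `P[x, 1] < S[1, 1]` and `S[1, 1] = S[x, 1]` for `x ∈ [m]`. -/
def separatingArgument {ι : Type} [DecidableEq ι] (P S : ι) (m : ℕ) : Finset (Comp ι) :=
  (Finset.Icc 1 m).image (fun x => ⟨P, [x, 1], S, [1, 1], Ordering.lt⟩) ∪
    (Finset.Icc 1 m).image (fun x => ⟨S, [1, 1], S, [x, 1], Ordering.eq⟩)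

lemma forall_mem_separatingArgument {ι : Type} [DecidableEq ι] {P S : ι} {m : ℕ}
    {q : Comp ι → Prop} :
    (∀ cc ∈ separatingArgument P S m, q cc) ↔ ∀ x ∈ Finset.Icc 1 m,
      q ⟨P, [x, 1], S, [1, 1], Ordering.lt⟩ ∧ q ⟨S, [1, 1], S, [x, 1], Ordering.eq⟩ := by
  simp only [separatingArgument, Finset.forall_mem_union, Finset.forall_mem_image]
  exact ⟨fun h x hx => ⟨h.1 hx, h.2 hx⟩, fun h => ⟨fun x hx => (h x hx).1, fun x hx => (h x hx).2⟩⟩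

lemma card_separatingArgument_le {ι : Type} [DecidableEq ι] (P S : ι) (m : ℕ) :
    (separatingArgument P S m).card ≤ 2 * m := by
  refine (Finset.card_union_le _ _).trans ?_
  rw [two_mul]
  exact add_le_add (Finset.card_image_le.trans (by simp)) (Finset.card_image_le.trans (by simp))

lemma lt_of_satComp_separatingArgument {ι : Type} [DecidableEq ι] {P S : ι} {m : ℕ}
    {v : ι → List ℕ → ℕ} (h : ∀ cc ∈ separatingArgument P S m, SatComp v cc) {i k : ℕ}
    (hi : i ∈ Finset.Icc 1 m) (hk : k ∈ Finset.Icc 1 m) : v P [i, 1] < v S [k, 1] := by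
  rw [forall_mem_separatingArgument] at h
  have hlt : v P [i, 1] < v S [1, 1] := compare_lt_iff_lt.1 (h i hi).1
  have heq : v S [1, 1] = v S [k, 1] := compare_eq_iff_eq.1 (h k hk).2
  exact heq ▸ hlt

lemma isCert_separatingArgument {w m c d : ℕ}
    {p s : {p : Fin (w + 1) × Fin (w + 1) // p.1 < p.2}} (hm : 1 ≤ m)
    (hp : IsConstRel w m p c) (hs : IsConstRel w m s d) (hps : p.val.2 = s.val.2) :
    IsCert (twAttrs w) (List.finRange (w + 1))
      (dbShape (twAttrs w) (List.finRange (w + 1)) (twDB w m))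
      (separatingArgument (Sum.inl p) (Sum.inl s) m) := by
  have hone : 1 ∈ Finset.Icc 1 m := Finset.mem_Icc.2 ⟨le_rfl, hm⟩
  have hno : ∀ v : TWIdx w → List ℕ → ℕ,
      (∀ cc ∈ separatingArgument (Sum.inl p) (Sum.inl s) m, SatComp v cc) → ∀ W,
      ¬ IsWitness (twAttrs w) (List.finRange (w + 1))
        (dbShape (twAttrs w) (List.finRange (w + 1)) (twDB w m)) v W := by
    rintro v hv W ⟨hW, t, ht⟩
    obtain ⟨i, hi, hit⟩ := hp.exists_value_eq_of_isWitness (hW _) ht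
    obtain ⟨k, hk, hkt⟩ := hs.exists_value_eq_of_isWitness (hW _) ht
    have hlt := lt_of_satComp_separatingArgument hv hi hk
    rw [hit, hkt, hps] at hlt
    exact lt_irrefl _ hlt
  refine ⟨forall_mem_separatingArgument.2 fun x hx => ⟨?_, ?_⟩, ?_⟩
  · exact ⟨hp.validIdx_pair hx, hs.validIdx_pair hone, by simp [attrList_twAttrs_inl, hps]⟩
  · exact ⟨hs.validIdx_pair hone, hs.validIdx_pair hx, by simp⟩
  · intro v v' _ _ hv hv' W
    exact iff_of_false (hno v hv W) (hno v' hv' W)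

/-- For every `w ≥ 2` and `m ≥ 2`, on the above instance of
`Q_w = (⋈_{i<j} R_{i,j}(v_i, v_j)) ⋈ U(v_1, …, v_{w+1})` with GAO `v_1, …, v_{w+1}`:
the output is empty, and there is a certificate of emptiness of size at most `c ⬝ w ⬝ m`
for an absolute constant `c`. -/
theorem stmt_16 :
    ∃ c : ℕ, 0 < c ∧ ∀ w m : ℕ, 2 ≤ w → 2 ≤ m →
      -- the output of `Q_w` on this instance is empty
      (¬ ∃ t : Fin (w + 1) → ℕ, ∀ R : TWIdx w,
        ∃ u ∈ twDB w m R, ∀ a ∈ twAttrs w R, u a = t a) ∧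
      -- and there is a certificate of size at most `c ⬝ w ⬝ m`
      (∃ A : Finset (Comp (TWIdx w)),
        IsCert (twAttrs w) (List.finRange (w + 1))
          (dbShape (twAttrs w) (List.finRange (w + 1)) (twDB w m)) A ∧
        (∀ cc ∈ A, SatComp (dbValue (twAttrs w) (List.finRange (w + 1)) (twDB w m)) cc) ∧
        A.card ≤ c * w * m) := by
  refine ⟨1, one_pos, fun w m hw hm => ?_⟩
  let p : {p : Fin (w + 1) × Fin (w + 1) // p.1 < p.2} :=
    ⟨(0, Fin.last w), by rw [Fin.lt_def]; simp; omega⟩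
  let s : {p : Fin (w + 1) × Fin (w + 1) // p.1 < p.2} :=
    ⟨(⟨w - 1, by omega⟩, Fin.last w), by rw [Fin.lt_def]; simp; omega⟩
  have hp : IsConstRel w m p 1 := ⟨by simp [twPairs, p]; omega⟩
  have hs : IsConstRel w m s 2 := ⟨by simp [twPairs, s]⟩
  refine ⟨?_, separatingArgument (Sum.inl p) (Sum.inl s) m,
    isCert_separatingArgument (by omega) hp hs rfl,
    forall_mem_separatingArgument.2 fun x hx => ?_, ?_⟩
  · rintro ⟨t, ht⟩
    obtain ⟨u, hu, hut⟩ := ht (Sum.inl p)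
    obtain ⟨u', hu', hut'⟩ := ht (Sum.inl s)
    have h₁ : t (Fin.last w) = 1 :=
      (hut (Fin.last w) (by simp [twAttrs, p])).symm.trans (hp.mem_twDB hu)
    have h₂ : t (Fin.last w) = 2 :=
      (hut' (Fin.last w) (by simp [twAttrs, s])).symm.trans (hs.mem_twDB hu')
    omega
  · have hone : 1 ∈ Finset.Icc 1 m := Finset.mem_Icc.2 ⟨le_rfl, by omega⟩
    constructor
    · simp only [SatComp, hp.dbValue_pair hx, hs.dbValue_pair hone]
      decide
    · simp only [SatComp, hs.dbValue_pair hx, hs.dbValue_pair hone]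
      decide
  · rw [one_mul]
    exact (card_separatingArgument_le _ _ m).trans (Nat.mul_le_mul_right m hw)
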